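/- arXiv:1809.10250 — 2 statements merged into one kernel-verified Lean document; each statement's English description precedes it below -/
import Mathlib

section
/- (Theorem 1, collision avoidance part) For all times t and all distinct agents i ≠ j, the actual positions satisfy ‖r_i(t) − r_j(t)‖ ≥ 2ε; in particular the closed ε-balls enclosing distinct quadrotors never overlap, so inter-agent collision avoidance is guaranteed. -/
open Matrix Metric Set

/-- Matrix-vector multiplication on Euclidean space. -/
noncomputable def mulVecE (Q : Matrix (Fin 2) (Fin 2) ℝ)
    (x : EuclideanSpace ℝ (Fin 2)) : EuclideanSpace ℝ (Fin 2) :=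
  (EuclideanSpace.equiv (Fin 2) ℝ).symm (Q.mulVec (EuclideanSpace.equiv (Fin 2) ℝ x))

/-- If `QᵀQ - c²I` is positive semidefinite, then `Q` expands norms by at least `c`. -/
lemma mul_norm_le_norm_mulVecE {Q : Matrix (Fin 2) (Fin 2) ℝ} {c : ℝ}
    (hQ : (Qᵀ * Q - c ^ 2 • (1 : Matrix (Fin 2) (Fin 2) ℝ)).PosSemidef)
    (x : EuclideanSpace ℝ (Fin 2)) : c * ‖x‖ ≤ ‖mulVecE Q x‖ := by
  refine (abs_le_of_sq_le_sq' ?_ (norm_nonneg _)).2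
  have h := hQ.dotProduct_mulVec_nonneg x.ofLp
  rw [mul_pow, EuclideanSpace.norm_sq_eq, EuclideanSpace.norm_sq_eq]
  simp [mulVecE, Matrix.mulVec, dotProduct, Matrix.mul_apply, Fin.sum_univ_two,
    Matrix.one_apply] at h ⊢
  linarith

lemma mulVecE_sub (Q : Matrix (Fin 2) (Fin 2) ℝ) (x y : EuclideanSpace ℝ (Fin 2)) :
    mulVecE Q (x - y) = mulVecE Q x - mulVecE Q y := by
  simp only [mulVecE, map_sub, Matrix.mulVec_sub]

/-- **Theorem 1, collision avoidance part.** Under the continuum deformation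
hypotheses (affinely independent leaders, followers initially inside the leading
triangle, eigenvalues of `U_D = (QᵀQ)^{1/2}` at least `λ_min = (δ+ε)/(δ_max+ε)`, and
tracking deviations bounded by `δ`), any two distinct agents stay at distance at least
`2ε` at all times, so the closed `ε`-balls enclosing distinct quadrotors never overlap
and inter-agent collision avoidance is guaranteed. -/
theorem continuum_deformation_collision_avoidance
    (N : ℕ) (hN : 4 ≤ N)
    (r0 : Fin N → EuclideanSpace ℝ (Fin 2))
    (hleaders : AffineIndependent ℝ ![r0 ⟨0, by omega⟩, r0 ⟨1, by omega⟩, r0 ⟨2, by omega⟩])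
    (hfollowers : ∀ i : Fin N, 3 ≤ (i : ℕ) →
      r0 i ∈ convexHull ℝ {r0 ⟨0, by omega⟩, r0 ⟨1, by omega⟩, r0 ⟨2, by omega⟩})
    (Q : ℝ → Matrix (Fin 2) (Fin 2) ℝ) (d : ℝ → EuclideanSpace ℝ (Fin 2))
    (ε : ℝ) (hε : 0 < ε)
    (Ds Db : ℝ)
    (hDs : ∀ i j : Fin N, i ≠ j → Ds ≤ ‖r0 i - r0 j‖)
    (hDb : ∀ i : Fin N, 3 ≤ (i : ℕ) → Db ≤ infDist (r0 i)
      (frontier (convexHull ℝ {r0 ⟨0, by omega⟩, r0 ⟨1, by omega⟩, r0 ⟨2, by omega⟩})))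
    (δ : ℝ) (hδ : 0 ≤ δ)
    (δmax : ℝ) (hδmax : δmax = min ((Ds - 2 * ε) / 2) (Db - ε)) (hδmaxpos : 0 < δmax)
    (lammin : ℝ) (hlam : lammin = (δ + ε) / (δmax + ε))
    (hQ : ∀ t : ℝ,
      ((Q t)ᵀ * Q t - lammin ^ 2 • (1 : Matrix (Fin 2) (Fin 2) ℝ)).PosSemidef)
    (r : Fin N → ℝ → EuclideanSpace ℝ (Fin 2))
    (hdev : ∀ (i : Fin N) (t : ℝ), ‖r i t - (mulVecE (Q t) (r0 i) + d t)‖ ≤ δ) :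
    ∀ (t : ℝ) (i j : Fin N), i ≠ j → 2 * ε ≤ ‖r i t - r j t‖ := by
  intro t i j hij
  have hsep : 2 * (δmax + ε) ≤ ‖r0 i - r0 j‖ := by
    have h := hδmax.trans_le (min_le_left _ _)
    linarith [hDs i j hij]
  have hpos : 0 < δmax + ε := by linarith
  have hlam0 : 0 ≤ lammin := hlam ▸ div_nonneg (by linarith) hpos.le
  have hlam_mul : lammin * (δmax + ε) = δ + ε := by
    rw [hlam, div_mul_cancel₀ _ hpos.ne']
  have hexp := mul_norm_le_norm_mulVecE (hQ t) (r0 i - r0 j)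
  have hmono := mul_le_mul_of_nonneg_left hsep hlam0
  have htri : ‖mulVecE (Q t) (r0 i - r0 j)‖ ≤ ‖r i t - r j t‖ + δ + δ := by
    have heq : mulVecE (Q t) (r0 i - r0 j) = (r i t - r j t)
        - (r i t - (mulVecE (Q t) (r0 i) + d t))
        + (r j t - (mulVecE (Q t) (r0 j) + d t)) := by
      rw [mulVecE_sub]
      abel
    rw [heq]
    exact (norm_add_le_of_le (norm_sub_le_of_le le_rfl (hdev i t)) (hdev j t))
  linarith
end

section
/- (Theorem 1, follower containment part) For every follower i ∈ {4,…,N} and every time t, the actual position r_i(t) lies in the leading triangle T_HT(t) = convexHull{r_{1,HT}(t), r_{2,HT}(t), r_{3,HT}(t)}; moreover the Euclidean infDist from r_i(t) to the frontier of T_HT(t) is at least ε, so no follower (including its enclosing ε-ball) leaves the leading triangle. -/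
open Matrix Metric Set

/-- The affine map `x ↦ Q x + v`, with `Q` acting through `mulVecE`. -/
noncomputable def affineMulVecE (Q : Matrix (Fin 2) (Fin 2) ℝ) (v : EuclideanSpace ℝ (Fin 2)) :
    EuclideanSpace ℝ (Fin 2) →ᵃ[ℝ] EuclideanSpace ℝ (Fin 2) :=
  (Q.toLpLin 2 2).toAffineMap + AffineMap.const ℝ _ v

lemma affineMulVecE_apply (Q : Matrix (Fin 2) (Fin 2) ℝ) (v x : EuclideanSpace ℝ (Fin 2)) :
    affineMulVecE Q v x = mulVecE Q x + v :=
  rfl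

lemma mul_norm_le_norm_toLpLin {Q : Matrix (Fin 2) (Fin 2) ℝ} {c : ℝ}
    (hQ : (Qᵀ * Q - c ^ 2 • (1 : Matrix (Fin 2) (Fin 2) ℝ)).PosSemidef)
    (x : EuclideanSpace ℝ (Fin 2)) : c * ‖x‖ ≤ ‖Q.toLpLin 2 2 x‖ := by
  refine le_of_sq_le_sq ?_ (norm_nonneg _)
  have h := hQ.dotProduct_mulVec_nonneg x.ofLp
  rw [mul_pow, EuclideanSpace.norm_sq_eq, EuclideanSpace.norm_sq_eq]
  simp [Matrix.mulVec, dotProduct, Matrix.mul_apply, Fin.sum_univ_two, Matrix.toLpLin_apply] at h ⊢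
  linarith

lemma ball_subset_of_le_infDist_frontier {E : Type*} [NormedAddCommGroup E] [NormedSpace ℝ E]
    {s : Set E} {x : E} {ρ : ℝ} (hx : x ∈ s) (h : ρ ≤ infDist x (frontier s)) :
    ball x ρ ⊆ s := by
  rcases le_or_gt ρ 0 with hρ | hρ
  · simp [ball_eq_empty.2 hρ]
  have hdisj : ∀ y ∈ ball x ρ, y ∉ frontier s := fun y hy hys ↦
    (h.trans (infDist_le_dist_of_mem hys)).not_gt (mem_ball'.1 hy)
  have hcover : ball x ρ ⊆ interior s ∪ (closure s)ᶜ := fun y hy ↦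
    or_iff_not_imp_left.2 fun hys hyc ↦ hdisj y hy ⟨hyc, hys⟩
  have hxs : x ∈ interior s := by
    by_contra hxs
    exact hdisj x (mem_ball_self hρ) ⟨subset_closure hx, hxs⟩
  refine ((convex_ball x ρ).isPreconnected.subset_left_of_subset_union isOpen_interior
    isClosed_closure.isOpen_compl ?_ hcover ⟨x, mem_ball_self hρ, hxs⟩).trans interior_subset
  exact disjoint_compl_right.mono_left (interior_subset.trans subset_closure)

lemma le_infDist_frontier_of_ball_subset {E : Type*} [NormedAddCommGroup E] [NormedSpace ℝ E]
    {s : Set E} {x : E} {ρ : ℝ} (hs : (frontier s).Nonempty) (h : ball x ρ ⊆ s) :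
    ρ ≤ infDist x (frontier s) := by
  rw [le_infDist hs]
  intro y hy
  by_contra! hxy
  exact hy.2 (interior_maximal h isOpen_ball (mem_ball'.2 hxy))

lemma ball_subset_image_ball {E : Type*} [NormedAddCommGroup E] [NormedSpace ℝ E]
    [FiniteDimensional ℝ E] {f : E →ᵃ[ℝ] E} {c : ℝ} (hc : 0 < c)
    (hf : ∀ x, c * ‖x‖ ≤ ‖f.linear x‖) (x : E) (ρ : ℝ) :
    ball (f x) (c * ρ) ⊆ f '' ball x ρ := by
  have hinj : Function.Injective f.linear := by
    rw [injective_iff_map_eq_zero]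
    intro y hy
    have := hf y
    rw [hy, norm_zero] at this
    exact norm_le_zero_iff.1 (nonpos_of_mul_nonpos_right this hc)
  intro y hy
  obtain ⟨z, rfl⟩ := f.linear_surjective_iff.1 (LinearMap.injective_iff_surjective.1 hinj) y
  refine ⟨z, ?_, rfl⟩
  rw [mem_ball_iff_norm] at hy ⊢
  have := hf (z - x)
  rw [← vsub_eq_sub, f.linearMap_vsub] at this
  exact lt_of_mul_lt_mul_left (this.trans_lt hy) hc.le

/-- **Theorem 1, follower containment part.** Under the continuum deformation
hypotheses (affinely independent leaders, followers initially inside the leading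
triangle, eigenvalues of `U_D = (QᵀQ)^{1/2}` at least `λ_min = (δ+ε)/(δ_max+ε)`, and
tracking deviations bounded by `δ`), every follower stays inside the leading triangle
`T_HT(t) = convexHull {r_{1,HT}(t), r_{2,HT}(t), r_{3,HT}(t)}` at every time, at
distance at least `ε` from its frontier: no follower (including its enclosing
`ε`-ball) leaves the leading triangle. -/
theorem continuum_deformation_follower_containment
    (N : ℕ) (hN : 4 ≤ N)
    (r0 : Fin N → EuclideanSpace ℝ (Fin 2))
    (hleaders : AffineIndependent ℝ ![r0 ⟨0, by omega⟩, r0 ⟨1, by omega⟩, r0 ⟨2, by omega⟩])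
    (hfollowers : ∀ i : Fin N, 3 ≤ (i : ℕ) →
      r0 i ∈ convexHull ℝ {r0 ⟨0, by omega⟩, r0 ⟨1, by omega⟩, r0 ⟨2, by omega⟩})
    (Q : ℝ → Matrix (Fin 2) (Fin 2) ℝ) (d : ℝ → EuclideanSpace ℝ (Fin 2))
    (rHT : Fin N → ℝ → EuclideanSpace ℝ (Fin 2))
    (hrHT : ∀ (i : Fin N) (t : ℝ), rHT i t = mulVecE (Q t) (r0 i) + d t)
    (ε : ℝ) (hε : 0 < ε)
    (Ds Db : ℝ)
    (hDs : ∀ i j : Fin N, i ≠ j → Ds ≤ ‖r0 i - r0 j‖)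
    (hDb : ∀ i : Fin N, 3 ≤ (i : ℕ) → Db ≤ infDist (r0 i)
      (frontier (convexHull ℝ {r0 ⟨0, by omega⟩, r0 ⟨1, by omega⟩, r0 ⟨2, by omega⟩})))
    (δ : ℝ) (hδ : 0 ≤ δ)
    (δmax : ℝ) (hδmax : δmax = min ((Ds - 2 * ε) / 2) (Db - ε)) (hδmaxpos : 0 < δmax)
    (lammin : ℝ) (hlam : lammin = (δ + ε) / (δmax + ε))
    (hQ : ∀ t : ℝ,
      ((Q t)ᵀ * Q t - lammin ^ 2 • (1 : Matrix (Fin 2) (Fin 2) ℝ)).PosSemidef)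
    (r : Fin N → ℝ → EuclideanSpace ℝ (Fin 2))
    (hdev : ∀ (i : Fin N) (t : ℝ), ‖r i t - rHT i t‖ ≤ δ) :
    ∀ i : Fin N, 3 ≤ (i : ℕ) → ∀ t : ℝ,
      r i t ∈ convexHull ℝ
        {rHT ⟨0, by omega⟩ t, rHT ⟨1, by omega⟩ t, rHT ⟨2, by omega⟩ t} ∧
      ε ≤ infDist (r i t) (frontier (convexHull ℝ
        {rHT ⟨0, by omega⟩ t, rHT ⟨1, by omega⟩ t, rHT ⟨2, by omega⟩ t})) := by
  intro i hi t
  have hρ : 0 < δmax + ε := by linarith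
  have hlampos : 0 < lammin := hlam ▸ by positivity
  have hDbρ : δmax + ε ≤ Db := by linarith [hδmax.trans_le (min_le_right _ _)]
  have himage : convexHull ℝ
      {rHT ⟨0, by omega⟩ t, rHT ⟨1, by omega⟩ t, rHT ⟨2, by omega⟩ t} =
      affineMulVecE (Q t) (d t) ''
        convexHull ℝ {r0 ⟨0, by omega⟩, r0 ⟨1, by omega⟩, r0 ⟨2, by omega⟩} := by
    simp only [AffineMap.image_convexHull, image_insert_eq, image_singleton, affineMulVecE_apply,
      hrHT]
  have hball : ball (r i t) ε ⊆ convexHull ℝ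
      {rHT ⟨0, by omega⟩ t, rHT ⟨1, by omega⟩ t, rHT ⟨2, by omega⟩ t} := by
    rw [himage]
    calc ball (r i t) ε ⊆ ball (affineMulVecE (Q t) (d t) (r0 i)) (lammin * (δmax + ε)) := by
          apply ball_subset_ball'
          rw [affineMulVecE_apply, ← hrHT, dist_eq_norm, hlam, div_mul_cancel₀ _ hρ.ne']
          linarith [hdev i t]
      _ ⊆ affineMulVecE (Q t) (d t) '' ball (r0 i) (δmax + ε) := by
          refine ball_subset_image_ball hlampos (fun x ↦ ?_) _ _
          simpa [affineMulVecE] using mul_norm_le_norm_toLpLin (hQ t) x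
      _ ⊆ _ := image_mono (ball_subset_of_le_infDist_frontier (hfollowers i hi)
          (hDbρ.trans (hDb i hi)))
  refine ⟨hball (mem_ball_self hε), le_infDist_frontier_of_ball_subset ?_ hball⟩
  have hbdd : Bornology.IsBounded (convexHull ℝ
      {rHT ⟨0, by omega⟩ t, rHT ⟨1, by omega⟩ t, rHT ⟨2, by omega⟩ t}) :=
    isBounded_convexHull.2 (by simp)
  refine nonempty_frontier_iff.2 ⟨⟨_, hball (mem_ball_self hε)⟩, fun h ↦ ?_⟩
  exact NormedSpace.unbounded_univ ℝ (EuclideanSpace ℝ (Fin 2)) (h ▸ hbdd)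
end
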